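/- arXiv:1909.07228 — 2 statements merged into one kernel-verified Lean document; each statement's English description precedes it below -/
import Mathlib

section
/- Let D, f : ℝ → ℝ be continuous with D of class C¹, and let φ : ℝ → ℝ be a C² solution of (D(φ)φ')' + f(φ) = 0 on ℝ such that φ'(x) < 0 and D(φ(x)) > 0 for all x ∈ ℝ, φ(x) → 0 as x → +∞, and D(φ(x))φ'(x) → 0 as x → +∞. Then 𝒟(φ(x)) ≤ 0 for all x ∈ ℝ and φ'(x) = −√2 · (−𝒟(φ(x)))^{1/2} / D(φ(x)) for all x ∈ ℝ. -/
open MeasureTheory Filter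

/-- For a monotone decreasing stationary degenerate front with `φ → 0` and
`D(φ)φ' → 0` at `+∞`, one has `𝒟(φ(x)) ≤ 0` and
`φ'(x) = −√2 (−𝒟(φ(x)))^{1/2} / D(φ(x))`, where `𝒟(s) = ∫₀ˢ D(u)f(u) du`. -/
theorem stmt_1 (D f φ : ℝ → ℝ)
    (hDc : Continuous D) (hfc : Continuous f)
    (hD : ContDiff ℝ 1 D) (hφ : ContDiff ℝ 2 φ)
    (hprofile : ∀ x : ℝ, deriv (fun y => D (φ y) * deriv φ y) x + f (φ x) = 0)
    (hmono : ∀ x : ℝ, deriv φ x < 0)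
    (hDpos : ∀ x : ℝ, 0 < D (φ x))
    (hlim : Tendsto φ atTop (nhds 0))
    (hlim' : Tendsto (fun x => D (φ x) * deriv φ x) atTop (nhds 0)) :
    ∀ x : ℝ, (∫ u in (0:ℝ)..(φ x), D u * f u) ≤ 0 ∧
      deriv φ x
        = - Real.sqrt 2 * Real.sqrt (-(∫ u in (0:ℝ)..(φ x), D u * f u)) / D (φ x) := by
  have hφd : Differentiable ℝ φ := hφ.differentiable (by norm_num)
  have hφ' : ContDiff ℝ 1 (deriv φ) := by
    have h2 : ContDiff ℝ (1 + 1) φ := by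
      have e : (1 + 1 : WithTop ℕ∞) = 2 := by norm_num
      rw [e]; exact hφ
    exact (contDiff_succ_iff_deriv.1 h2).2.2
  have hwd : Differentiable ℝ (fun y => D (φ y) * deriv φ y) :=
    ((hD.differentiable (by norm_num)).comp hφd).mul (hφ'.differentiable (by norm_num))
  have hc : Continuous (fun u => D u * f u) := hDc.mul hfc
  have hF : ∀ s : ℝ, HasDerivAt (fun s => ∫ u in (0:ℝ)..s, D u * f u) (D s * f s) s :=
    fun s => intervalIntegral.integral_hasDerivAt_right (hc.intervalIntegrable _ _)
      hc.stronglyMeasurable.stronglyMeasurableAtFilter hc.continuousAt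
  set F : ℝ → ℝ := fun s => ∫ u in (0:ℝ)..s, D u * f u with hFdef
  have hE : ∀ x, HasDerivAt (fun x => (D (φ x) * deriv φ x) ^ 2 + 2 * F (φ x)) 0 x := by
    intro x
    have h1 := ((hwd x).hasDerivAt.pow 2).add
      (((hF (φ x)).comp x (hφd x).hasDerivAt).const_mul 2)
    refine h1.congr_deriv ?_
    have h3 : deriv (fun y => D (φ y) * deriv φ y) x = - f (φ x) := by
      linarith [hprofile x]
    rw [h3]; push_cast; ring
  have hlimE : Tendsto (fun x => (D (φ x) * deriv φ x) ^ 2 + 2 * F (φ x)) atTop (nhds 0) := by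
    have h1 : Tendsto (fun x => F (φ x)) atTop (nhds (F 0)) :=
      (hF 0).continuousAt.tendsto.comp hlim
    have h0 : F 0 = 0 := by simp [hFdef]
    have h2 := (hlim'.pow 2).add (h1.const_mul 2)
    simpa [h0] using h2
  have hEz : ∀ x, (D (φ x) * deriv φ x) ^ 2 + 2 * F (φ x) = 0 := by
    intro x
    have hconst := is_const_of_deriv_eq_zero (fun y => (hE y).differentiableAt)
      (fun y => (hE y).deriv)
    refine tendsto_nhds_unique ?_ hlimE
    exact tendsto_const_nhds.congr (fun y => hconst x y)
  intro x
  change F (φ x) ≤ 0 ∧ deriv φ x = - Real.sqrt 2 * Real.sqrt (-(F (φ x))) / D (φ x)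
  have hx := hEz x
  refine ⟨by nlinarith [sq_nonneg (D (φ x) * deriv φ x)], ?_⟩
  have hs : Real.sqrt 2 * Real.sqrt (-(F (φ x))) = -(D (φ x) * deriv φ x) := by
    rw [← Real.sqrt_mul (by norm_num)]
    have e : 2 * -(F (φ x)) = (-(D (φ x) * deriv φ x)) ^ 2 := by linarith [hx, neg_sq (D (φ x) * deriv φ x)]
    rw [e, Real.sqrt_sq]
    nlinarith [mul_neg_of_pos_of_neg (hDpos x) (hmono x)]
  rw [eq_div_iff (hDpos x).ne', neg_mul, hs]
  ring
end

section
/- Let d > 0, β₁, β₀ ∈ ℝ, and λ ∈ ℂ with Re λ > β₀. Then the quadratic polynomial q(z) = d z² + β₁ z + (β₀ − λ) has no purely imaginary root, and it has exactly one root with strictly negative real part and exactly one root with strictly positive real part (consistent splitting of the asymptotic coefficient matrices of the spectral first-order system). -/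
open Complex

/-- Consistent splitting: for `d > 0`, `Re λ > β₀`, the quadratic
`q(z) = dz² + β₁z + (β₀ − λ)` has no purely imaginary root, exactly one root with
negative real part and exactly one root with positive real part. -/
theorem stmt_8 (d β₁ β₀ : ℝ) (lam : ℂ) (hd : 0 < d) (hre : β₀ < lam.re) :
    (∀ z : ℂ, z.re = 0 → (d : ℂ) * z ^ 2 + (β₁ : ℂ) * z + ((β₀ : ℂ) - lam) ≠ 0) ∧
    ∃ z₁ z₂ : ℂ, z₁.re < 0 ∧ 0 < z₂.re ∧
      ∀ z : ℂ, ((d : ℂ) * z ^ 2 + (β₁ : ℂ) * z + ((β₀ : ℂ) - lam) = 0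
        ↔ (z = z₁ ∨ z = z₂)) := by
  constructor
  · intro z hz h
    have h1 := congrArg Complex.re h
    simp [pow_two, hz] at h1
    nlinarith [mul_nonneg hd.le (mul_self_nonneg z.im)]
  · have hdc : (d : ℂ) ≠ 0 := by exact_mod_cast hd.ne'
    obtain ⟨s, hs, hs0⟩ : ∃ s : ℂ, s * s = (β₁ : ℂ) ^ 2 + 4 * d * (lam - β₀) ∧ 0 ≤ s.re := by
      obtain ⟨s, hs⟩ := IsAlgClosed.exists_pow_nat_eq
        ((β₁ : ℂ) ^ 2 + 4 * d * (lam - β₀)) (n := 2) (by norm_num)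
      rcases le_total 0 s.re with h | h
      · exact ⟨s, by rw [← hs]; ring, h⟩
      · exact ⟨-s, by rw [← hs]; ring, by simpa using h⟩
    have h1 := congrArg Complex.re hs
    simp [pow_two] at h1
    have h2 : β₁ ^ 2 < s.re ^ 2 := by
      nlinarith [mul_pos hd (sub_pos.2 hre), mul_self_nonneg s.im]
    obtain ⟨h3, h4⟩ := abs_lt.1 (abs_lt_of_sq_lt_sq h2 hs0)
    have key : ∀ w : ℂ, (w / ((2 * d : ℝ) : ℂ)).re = w.re / (2 * d) := fun w =>
      Complex.div_ofReal_re w (2 * d)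
    refine ⟨(-β₁ - s) / ((2 * d : ℝ) : ℂ), (-β₁ + s) / ((2 * d : ℝ) : ℂ), ?_, ?_, ?_⟩
    · rw [key]
      apply div_neg_of_neg_of_pos _ (by positivity)
      simp; linarith
    · rw [key]
      apply div_pos _ (by positivity)
      simp; linarith
    · intro z
      have hd2 : ((2 * d : ℝ) : ℂ) ≠ 0 := by exact_mod_cast (by positivity : (2 * d) ≠ 0)
      rw [eq_div_iff hd2, eq_div_iff hd2]
      push_cast
      have e : 4 * (d : ℂ) * ((d : ℂ) * z ^ 2 + (β₁ : ℂ) * z + ((β₀ : ℂ) - lam))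
          = (z * (2 * d) - (-β₁ - s)) * (z * (2 * d) - (-β₁ + s)) := by
        linear_combination hs
      have h4d : 4 * (d : ℂ) ≠ 0 := mul_ne_zero (by norm_num) hdc
      rw [← sub_eq_zero (a := z * (2 * (d : ℂ))) (b := -β₁ - s),
        ← sub_eq_zero (a := z * (2 * (d : ℂ))) (b := -β₁ + s), ← mul_eq_zero, ← e, mul_eq_zero]
      simp [hdc]
end
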